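/- Let p be an odd prime and let s : ZMod p → ℤ be the Legendre sequence. For q ∈ ZMod p with q ≠ 0, the unnormalized discrete Fourier transform S q = Σ_{k : ZMod p} (s k : ℂ) * exp(2πi·k·q/p) satisfies: S q = χ(q)·√p + 1 if p ≡ 1 (mod 4), and S q = χ(q)·i·√p + 1 if p ≡ 3 (mod 4). In particular, ‖S q‖² = ‖χ(q) + 1/√p‖²·p in the first case and ‖S q‖² = p + 1 in the second case, for all q ≠ 0. -/

import Mathlib

/-- The unnormalized discrete Fourier transform of `x : ZMod N → ℂ`. -/
noncomputable def dft {N : ℕ} [NeZero N] (x : ZMod N → ℂ) (q : ZMod N) : ℂ :=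
  ∑ k : ZMod N, x k * Complex.exp (2 * Real.pi * Complex.I * k.val * q.val / N)

/-- The Legendre symbol as a function `ZMod p → ℤ`. -/
def legChar (p : ℕ) [Fact p.Prime] (k : ZMod p) : ℤ := legendreSym p k.val

/-- The Legendre sequence: `1` at `0`, the Legendre symbol elsewhere. -/
def legSeq (p : ℕ) [Fact p.Prime] (k : ZMod p) : ℤ :=
  if k = 0 then 1 else legChar p k

open Finset Polynomial

section SineProduct

lemma exp_pow_sub_exp_pow_sub (n k : ℕ) (hk : k ≤ n) (hn : n ≠ 0) :
    Complex.exp (2 * Real.pi * Complex.I / n) ^ k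
        - Complex.exp (2 * Real.pi * Complex.I / n) ^ (n - k)
      = Complex.I * ((2 * Real.sin (2 * Real.pi * k / n) : ℝ) : ℂ) := by
  have hn' : (n : ℂ) ≠ 0 := by exact_mod_cast hn
  have h : Complex.exp (2 * Real.pi * Complex.I / n) ^ (n - k)
      = Complex.exp (-(2 * Real.pi * k / n) * Complex.I) := by
    rw [← Complex.exp_nat_mul, Nat.cast_sub hk,
      ← Complex.exp_periodic (-(2 * Real.pi * k / n) * Complex.I)]
    congr 1
    field_simp
    ring
  have h' : Complex.exp (2 * Real.pi * Complex.I / n) ^ k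
      = Complex.exp ((2 * Real.pi * k / n) * Complex.I) := by
    rw [← Complex.exp_nat_mul]
    congr 1
    field_simp
  rw [h, h']
  push_cast
  rw [Complex.two_sin]
  linear_combination (Complex.exp ((2 * Real.pi * k / n) * Complex.I)
    - Complex.exp (-(2 * Real.pi * k / n) * Complex.I)) * Complex.I_sq

lemma IsPrimitiveRoot.prod_norm_one_sub_pow {m : ℕ} {η : ℂ}
    (hη : IsPrimitiveRoot η (2 * m + 1)) :
    (∏ k ∈ range m, ‖1 - η ^ (k + 1)‖) ^ 2 = 2 * m + 1 := by
  have hη1 : ‖η‖ = 1 := hη.norm'_eq_one (by omega)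
  have hrefl : ∀ k ∈ range m, ‖1 - η ^ (m + (m - 1 - k) + 1)‖ = ‖1 - η ^ (k + 1)‖ := by
    intro k hk
    have hk := mem_range.mp hk
    have h1 : η ^ (k + 1) * η ^ (m + (m - 1 - k) + 1) = 1 := by
      rw [← pow_add, show k + 1 + (m + (m - 1 - k) + 1) = 2 * m + 1 by omega, hη.pow_eq_one]
    calc ‖1 - η ^ (m + (m - 1 - k) + 1)‖
        = ‖η ^ (k + 1)‖ * ‖1 - η ^ (m + (m - 1 - k) + 1)‖ := by simp [hη1]
      _ = ‖η ^ (k + 1) - 1‖ := by rw [← norm_mul, mul_sub, h1, mul_one]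
      _ = _ := norm_sub_rev _ _
  have h := congrArg norm hη.prod_one_sub_pow_eq_order
  rw [norm_prod, two_mul, prod_range_add,
    ← prod_range_reflect (fun k => ‖1 - η ^ (m + k + 1)‖), prod_congr rfl hrefl, ← sq] at h
  rw [h]
  have h2 : ((m + m : ℕ) : ℂ) + 1 = ((2 * m + 1 : ℝ) : ℂ) := by push_cast; ring
  rw [h2, Complex.norm_real, Real.norm_of_nonneg (by positivity)]

lemma prod_exp_pow_sub_exp_pow_sub (m : ℕ) :
    ∏ k ∈ range m, (Complex.exp (2 * Real.pi * Complex.I / (2 * m + 1 : ℕ)) ^ (k + 1)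
        - Complex.exp (2 * Real.pi * Complex.I / (2 * m + 1 : ℕ)) ^ (2 * m + 1 - (k + 1)))
      = Complex.I ^ m * (Real.sqrt (2 * m + 1 : ℕ) : ℂ) := by
  set ζ := Complex.exp (2 * Real.pi * Complex.I / (2 * m + 1 : ℕ)) with hζ
  have hprim : IsPrimitiveRoot ζ (2 * m + 1) := Complex.isPrimitiveRoot_exp _ (by omega)
  have hη : IsPrimitiveRoot (ζ ^ 2) (2 * m + 1) :=
    hprim.pow_of_coprime 2 (by simp)
  have hζ1 : ‖ζ‖ = 1 := hprim.norm'_eq_one (by omega)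
  set r : ℕ → ℝ := fun k => 2 * Real.sin (2 * Real.pi * (k + 1 : ℕ) / (2 * m + 1 : ℕ)) with hr
  have hfac : ∀ k ∈ range m, ζ ^ (k + 1) - ζ ^ (2 * m + 1 - (k + 1)) = Complex.I * (r k : ℂ) := by
    intro k hk
    have hk := mem_range.mp hk
    exact exp_pow_sub_exp_pow_sub _ _ (by omega) (by omega)
  have hpos : ∀ k ∈ range m, 0 < r k := by
    intro k hk
    have hk : (k : ℝ) + 1 ≤ m := by exact_mod_cast mem_range.mp hk
    have hpi := Real.pi_pos
    refine mul_pos two_pos (Real.sin_pos_of_pos_of_lt_pi (by positivity) ?_)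
    push_cast
    rw [div_lt_iff₀ (by positivity)]
    nlinarith
  have hnorm : ∀ k ∈ range m, r k = ‖1 - (ζ ^ 2) ^ (k + 1)‖ := by
    intro k hk
    have h1 : ζ ^ (k + 1) * ζ ^ (2 * m + 1 - (k + 1)) = 1 := by
      have hk := mem_range.mp hk
      rw [← pow_add, show k + 1 + (2 * m + 1 - (k + 1)) = 2 * m + 1 by omega, hprim.pow_eq_one]
    calc r k = ‖Complex.I * (r k : ℂ)‖ := by
          rw [norm_mul, Complex.norm_I, one_mul, Complex.norm_real,
            Real.norm_of_nonneg (hpos k hk).le]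
      _ = ‖ζ ^ (k + 1)‖ * ‖ζ ^ (k + 1) - ζ ^ (2 * m + 1 - (k + 1))‖ := by
          rw [← hfac k hk]; simp [hζ1]
      _ = ‖(ζ ^ 2) ^ (k + 1) - 1‖ := by
          rw [← norm_mul, mul_sub, h1]; ring_nf
      _ = _ := norm_sub_rev _ _
  have hprod : ∏ k ∈ range m, r k = Real.sqrt (2 * m + 1 : ℕ) := by
    symm
    rw [Real.sqrt_eq_iff_eq_sq (by positivity) (prod_nonneg fun k hk => (hpos k hk).le),
      prod_congr rfl hnorm, hη.prod_norm_one_sub_pow]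
    push_cast; rfl
  rw [prod_congr rfl hfac, prod_mul_distrib, prod_const, card_range, ← hprod]
  push_cast; rfl

end SineProduct

section ModP

variable {p : ℕ} [Fact p.Prime]

lemma ZMod.sum_X_pow_eq_X_sub_one_pow :
    ∑ j ∈ range p, (X : (ZMod p)[X]) ^ j = (X - 1) ^ (p - 1) := by
  have hp := (Fact.out : p.Prime).pos
  have h : (X : (ZMod p)[X]) - 1 ≠ 0 := X_sub_C_ne_zero (1 : ZMod p)
  apply mul_right_cancel₀ h
  rw [geom_sum_mul, ← pow_succ, Nat.sub_add_cancel hp, sub_pow_char, one_pow]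

lemma ZMod.exists_sum_pow_mul_X_pow_eq (n : ℕ) (hn : n ≤ p - 1) :
    ∃ g : (ZMod p)[X], ∑ j ∈ range p, C ((j : ZMod p) ^ n) * X ^ j = (X - 1) ^ (p - 1 - n) * g ∧
      g.eval 1 = (-1) ^ n * (n.factorial : ZMod p) := by
  induction n with
  | zero => exact ⟨1, by simp [ZMod.sum_X_pow_eq_X_sub_one_pow], by simp⟩
  | succ n ih =>
    obtain ⟨g, hg, hg1⟩ := ih (by omega)
    obtain ⟨d, hd⟩ : ∃ d, p - 1 - n = d + 1 := ⟨p - 1 - n - 1, by omega⟩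
    have hdn : (d : ZMod p) + 1 = -(n + 1) := by
      have hp := (Fact.out : p.Prime).pos
      have : ((d + 1 + (n + 1) : ℕ) : ZMod p) = 0 := by
        rw [show d + 1 + (n + 1) = p by omega, CharP.cast_eq_zero]
      push_cast at this
      linear_combination this
    refine ⟨X * (C ((d : ZMod p) + 1) * g + (X - 1) * derivative g), ?_, ?_⟩
    · have hder : ∑ j ∈ range p, C ((j : ZMod p) ^ (n + 1)) * X ^ j
          = X * derivative (∑ j ∈ range p, C ((j : ZMod p) ^ n) * (X : (ZMod p)[X]) ^ j) := by
        rw [derivative_sum, mul_sum]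
        refine sum_congr rfl fun j _ => ?_
        rw [derivative_C_mul_X_pow]
        rcases j with _ | j
        · simp
        · rw [Nat.add_sub_cancel, ← pow_succ, pow_succ X j]
          ring
      rw [hder, hg, show p - 1 - (n + 1) = d by omega, hd]
      simp only [derivative_mul, derivative_pow, derivative_sub, derivative_X, derivative_one,
        Nat.add_sub_cancel, Nat.cast_add, Nat.cast_one, C_add, C_1, map_natCast]
      ring
    · simp only [eval_mul, eval_X, eval_add, eval_C, eval_sub, eval_one, hg1, hdn,
        Nat.factorial_succ]
      push_cast
      ring

lemma ZMod.exists_X_pow_sub_X_pow_eq (a : ℕ) (ha : a ≤ p) :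
    ∃ h : (ZMod p)[X], X ^ a - X ^ (p - a) = (X - 1) * h ∧ h.eval 1 = 2 * a := by
  obtain ⟨h, hh⟩ : (X - C 1 : (ZMod p)[X]) ∣ X ^ a - X ^ (p - a) := by
    rw [dvd_iff_isRoot]; simp
  refine ⟨h, by simpa using hh, ?_⟩
  have := congrArg (fun f => (derivative f).eval 1) hh
  simp only [derivative_sub, derivative_X_pow, derivative_mul, derivative_X, derivative_C,
    eval_sub, eval_mul, eval_add, eval_pow, eval_X, eval_C, eval_one, one_pow, eval_zero] at this
  simp [Nat.cast_sub ha] at this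
  linear_combination -this

lemma ZMod.eq_sign_of_X_sub_one_pow_dvd {m : ℕ} (hp : p = 2 * m + 1) (ε : ZMod p)
    (hdvd : (X - 1 : (ZMod p)[X]) ^ (p - 1) ∣ ∑ j ∈ range p, C ((j : ZMod p) ^ m) * X ^ j
      - C ε * ∏ k ∈ range m, (X ^ (k + 1) - X ^ (p - (k + 1)))) :
    ε * 2 ^ m = (-1) ^ m := by
  have hprime : p.Prime := Fact.out
  have hm : m ≠ 0 := by rintro rfl; exact hprime.one_lt.ne' (by omega)
  obtain ⟨g, hg, hg1⟩ := ZMod.exists_sum_pow_mul_X_pow_eq (p := p) m (by omega)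
  have hex : ∀ k : ℕ, ∃ h : (ZMod p)[X], k ∈ range m →
      X ^ (k + 1) - X ^ (p - (k + 1)) = (X - 1) * h ∧ h.eval 1 = 2 * ((k + 1 : ℕ) : ZMod p) := by
    intro k
    by_cases hk : k ∈ range m
    · obtain ⟨h, hh⟩ := ZMod.exists_X_pow_sub_X_pow_eq (p := p) (k + 1)
        (by have := mem_range.mp hk; omega)
      exact ⟨h, fun _ => hh⟩
    · exact ⟨0, fun h => absurd h hk⟩
  choose h hh using hex
  obtain ⟨w, hw⟩ := hdvd
  rw [hg, prod_congr rfl fun k hk => (hh k hk).1, prod_mul_distrib, prod_const, card_range,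
    show p - 1 - m = m by omega, show p - 1 = m + m by omega, pow_add] at hw
  have hX : (X - 1 : (ZMod p)[X]) ^ m ≠ 0 := pow_ne_zero _ (X_sub_C_ne_zero (1 : ZMod p))
  have hw' : g - C ε * ∏ k ∈ range m, h k = (X - 1) ^ m * w := by
    apply mul_left_cancel₀ hX
    linear_combination hw
  have hev := congrArg (eval 1) hw'
  rw [eval_sub, eval_mul, eval_C, eval_prod, prod_congr rfl fun k hk => (hh k hk).2, hg1,
    prod_mul_distrib, prod_const, card_range, ← Nat.cast_prod, prod_range_add_one_eq_factorial]
    at hev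
  simp only [eval_mul, eval_pow, eval_sub, eval_X, eval_one, sub_self, zero_pow hm, zero_mul]
    at hev
  have hfac : (m.factorial : ZMod p) ≠ 0 := by
    rw [Ne, ZMod.natCast_eq_zero_iff, hprime.dvd_factorial]
    omega
  apply mul_right_cancel₀ hfac
  linear_combination -hev

end ModP

section GaussSum

variable (p : ℕ) [Fact p.Prime]

/-- The Legendre symbol as a complex-valued multiplicative character. -/
noncomputable def legendreMulChar : MulChar (ZMod p) ℂ :=
  (quadraticChar (ZMod p)).ringHomComp (Int.castRingHom ℂ)

lemma legChar_eq_quadraticChar (k : ZMod p) : legChar p k = quadraticChar (ZMod p) k := by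
  simp [legChar, legendreSym]

lemma gaussSum_legendreMulChar_eq_sum :
    gaussSum (legendreMulChar p) ZMod.stdAddChar
      = ∑ j ∈ range p, ((quadraticChar (ZMod p) (j : ZMod p) : ℤ) : ℂ)
          * Complex.exp (2 * Real.pi * Complex.I / p) ^ j := by
  symm
  refine sum_bij (fun j _ => (j : ZMod p)) (fun _ _ => mem_univ _) ?_ ?_ ?_
  · intro a ha b hb hab
    rw [← ZMod.val_cast_of_lt (mem_range.mp ha), hab, ZMod.val_cast_of_lt (mem_range.mp hb)]
  · intro b _
    exact ⟨b.val, mem_range.mpr b.val_lt, by simp⟩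
  · intro j _
    have h := ZMod.stdAddChar_coe (N := p) (j : ℤ)
    rw [Int.cast_natCast] at h
    rw [h, ← Complex.exp_nat_mul, legendreMulChar, MulChar.ringHomComp_apply]
    congr 2
    push_cast
    ring

variable {p}

lemma gaussSum_legendreMulChar_sq (hp : p ≠ 2) :
    gaussSum (legendreMulChar p) ZMod.stdAddChar ^ 2 = (-1) ^ (p / 2) * p := by
  have hchar : ringChar (ZMod p) ≠ 2 := by rwa [ZMod.ringChar_zmod_n]
  have hquad : (legendreMulChar p).IsQuadratic := (quadraticChar_isQuadratic _).comp _
  have hne : legendreMulChar p ≠ 1 :=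
    (MulChar.ringHomComp_ne_one_iff (RingHom.injective_int _)).mpr (quadraticChar_ne_one hchar)
  rw [gaussSum_sq hne hquad (ZMod.isPrimitive_stdAddChar p), legendreMulChar,
    MulChar.ringHomComp_apply, quadraticChar_neg_one hchar, ZMod.card,
    ZMod.χ₄_eq_neg_one_pow ((Fact.out : p.Prime).eq_two_or_odd.resolve_left hp)]
  simp

/-- **Gauss's theorem on the sign of the quadratic Gauss sum.** -/
theorem gaussSum_legendreMulChar {m : ℕ} (hp : p = 2 * m + 1) :
    gaussSum (legendreMulChar p) ZMod.stdAddChar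
      = (ZMod.χ₈' p : ℂ) * (Complex.I ^ m * (Real.sqrt p : ℂ)) := by
  have hprime : p.Prime := Fact.out
  have hp2 : p ≠ 2 := by omega
  have hchar : ringChar (ZMod p) ≠ 2 := by rwa [ZMod.ringChar_zmod_n]
  set G := gaussSum (legendreMulChar p) ZMod.stdAddChar with hG
  set ζ := Complex.exp (2 * Real.pi * Complex.I / p) with hζ
  have hprim : IsPrimitiveRoot ζ p := Complex.isPrimitiveRoot_exp _ hprime.ne_zero
  have hQ : ∏ k ∈ range m, (ζ ^ (k + 1) - ζ ^ (p - (k + 1)))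
      = Complex.I ^ m * (Real.sqrt p : ℂ) := by
    have := prod_exp_pow_sub_exp_pow_sub m
    rwa [← hp] at this
  obtain ⟨ε, hε, hGε⟩ : ∃ ε : ℤ, (ε = 1 ∨ ε = -1) ∧
      G = (ε : ℂ) * (Complex.I ^ m * (Real.sqrt p : ℂ)) := by
    have hsq : G ^ 2 = (Complex.I ^ m * (Real.sqrt p : ℂ)) ^ 2 := by
      rw [gaussSum_legendreMulChar_sq hp2, mul_pow, ← pow_mul, mul_comm m 2, pow_mul,
        Complex.I_sq, ← Complex.ofReal_pow, Real.sq_sqrt (Nat.cast_nonneg p),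
        show p / 2 = m by omega, Complex.ofReal_natCast]
    rcases sq_eq_sq_iff_eq_or_eq_neg.mp hsq with h | h
    · exact ⟨1, Or.inl rfl, by simpa using h⟩
    · exact ⟨-1, Or.inr rfl, by simpa using h⟩
  have hdvd : cyclotomic p ℤ ∣
      ∑ j ∈ range p, C (quadraticChar (ZMod p) (j : ZMod p)) * X ^ j
        - C ε * ∏ k ∈ range m, (X ^ (k + 1) - X ^ (p - (k + 1))) := by
    rw [cyclotomic_eq_minpoly hprim hprime.pos]
    refine minpoly.isIntegrallyClosed_dvd (hprim.isIntegral hprime.pos) ?_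
    simp only [map_sub, map_sum, map_mul, map_prod, map_pow, aeval_X, aeval_C]
    simp only [algebraMap_int_eq, eq_intCast]
    rw [hQ, ← hGε, hG, gaussSum_legendreMulChar_eq_sum, sub_self]
  have hmod := Polynomial.map_dvd (Int.castRingHom (ZMod p)) hdvd
  have hpow : ∀ a : ZMod p, ((quadraticChar (ZMod p) a : ℤ) : ZMod p) = a ^ m := by
    intro a
    rw [quadraticChar_eq_pow_of_char_ne_two' hchar, ZMod.card, show p / 2 = m by omega]
  rw [map_cyclotomic, cyclotomic_prime, ZMod.sum_X_pow_eq_X_sub_one_pow] at hmod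
  simp only [Polynomial.map_sub, Polynomial.map_sum, Polynomial.map_mul, Polynomial.map_prod,
    Polynomial.map_pow, map_X, map_C] at hmod
  simp only [Int.coe_castRingHom, hpow] at hmod
  have hsign := ZMod.eq_sign_of_X_sub_one_pow_dvd hp (ε : ZMod p) hmod
  have hεχ : ((ZMod.χ₈' p : ℤ) : ZMod p) = ε := by
    have h2 : (2 : ZMod p) ≠ 0 := by
      have := Ring.two_ne_zero hchar
      exact this
    have hfermat : (2 : ZMod p) ^ m * 2 ^ m = 1 := by
      rw [← pow_add, show m + m = p - 1 by omega, ZMod.pow_card_sub_one_eq_one h2]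
    have h := quadraticChar_neg_two hchar
    rw [ZMod.card] at h
    rw [← h, hpow, neg_pow, ← hsign, mul_assoc, hfermat, mul_one]
  have hne : (1 : ZMod p) ≠ -1 := (Ring.neg_one_ne_one_of_char_ne_two hchar).symm
  have hχ : ZMod.χ₈' p = ε := by
    rw [ZMod.χ₈'_nat_eq_if_mod_eight, if_neg (by omega)] at hεχ ⊢
    split_ifs at hεχ ⊢ <;> rcases hε with rfl | rfl <;> push_cast at hεχ
    exacts [rfl, absurd hεχ hne, absurd hεχ.symm hne, rfl]
  rw [hGε, hχ]

theorem gaussSum_legendreMulChar_of_mod_four_eq_one (hp : p % 4 = 1) :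
    gaussSum (legendreMulChar p) ZMod.stdAddChar = (Real.sqrt p : ℂ) := by
  rw [gaussSum_legendreMulChar (m := p / 2) (by omega), ZMod.χ₈'_nat_eq_if_mod_eight,
    if_neg (by omega), Complex.I_pow_eq_pow_mod]
  rcases (by omega : p % 8 = 1 ∨ p % 8 = 5) with h | h
  · simp [h, show p / 2 % 4 = 0 by omega]
  · simp [h, show p / 2 % 4 = 2 by omega]

theorem gaussSum_legendreMulChar_of_mod_four_eq_three (hp : p % 4 = 3) :
    gaussSum (legendreMulChar p) ZMod.stdAddChar = Complex.I * (Real.sqrt p : ℂ) := by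
  rw [gaussSum_legendreMulChar (m := p / 2) (by omega), ZMod.χ₈'_nat_eq_if_mod_eight,
    if_neg (by omega), Complex.I_pow_eq_pow_mod]
  rcases (by omega : p % 8 = 3 ∨ p % 8 = 7) with h | h
  · simp [h, show p / 2 % 4 = 1 by omega]
  · simp [h, show p / 2 % 4 = 3 by omega]

lemma dft_legSeq {q : ZMod p} (hq : q ≠ 0) :
    dft (fun k => ((legSeq p k : ℤ) : ℂ)) q
      = (legChar p q : ℂ) * gaussSum (legendreMulChar p) ZMod.stdAddChar + 1 := by
  have hexp : ∀ k : ZMod p, Complex.exp (2 * Real.pi * Complex.I * k.val * q.val / p)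
      = ZMod.stdAddChar (q * k) := by
    intro k
    have h := ZMod.stdAddChar_coe (N := p) ((q.val * k.val : ℕ) : ℤ)
    rw [Int.cast_natCast, Nat.cast_mul, ZMod.natCast_zmod_val, ZMod.natCast_zmod_val] at h
    rw [h]
    congr 1
    push_cast
    ring
  have hseq : ∀ k : ZMod p, ((legSeq p k : ℤ) : ℂ)
      = legendreMulChar p k + if k = 0 then 1 else 0 := by
    intro k
    by_cases hk : k = 0
    · simp [legSeq, hk, MulChar.map_zero]
    · simp [legSeq, hk, legChar_eq_quadraticChar, legendreMulChar]
  have hquad : (legendreMulChar p).IsQuadratic := (quadraticChar_isQuadratic _).comp _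
  have hshift := gaussSum_mulShift_eq (legendreMulChar p) ZMod.stdAddChar (Units.mk0 q hq)
  rw [hquad.inv, Units.val_mk0] at hshift
  have hχ : (legChar p q : ℂ) = legendreMulChar p q := by
    simp [legChar_eq_quadraticChar, legendreMulChar]
  rw [hχ, ← hshift]
  simp only [dft, hexp, hseq, add_mul, sum_add_distrib, gaussSum, AddChar.mulShift_apply]
  simp

lemma legChar_sq {q : ZMod p} (hq : q ≠ 0) : legChar p q ^ 2 = 1 := by
  rw [legChar_eq_quadraticChar, quadraticChar_sq_one hq]

end GaussSum

theorem stmt_18 (p : ℕ) [Fact p.Prime] (hodd : Odd p) (q : ZMod p) (hq : q ≠ 0) :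
    (p % 4 = 1 →
      dft (fun k => ((legSeq p k : ℤ) : ℂ)) q
          = (legChar p q : ℂ) * (Real.sqrt p : ℂ) + 1 ∧
      ‖dft (fun k => ((legSeq p k : ℤ) : ℂ)) q‖ ^ 2
          = ‖(legChar p q : ℂ) + 1 / (Real.sqrt p : ℂ)‖ ^ 2 * p) ∧
    (p % 4 = 3 →
      dft (fun k => ((legSeq p k : ℤ) : ℂ)) q
          = (legChar p q : ℂ) * Complex.I * (Real.sqrt p : ℂ) + 1 ∧
      ‖dft (fun k => ((legSeq p k : ℤ) : ℂ)) q‖ ^ 2 = p + 1) := by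
  have hp0 : (0 : ℝ) < p := by exact_mod_cast (Fact.out : p.Prime).pos
  have hsqrt : Real.sqrt p ^ 2 = p := Real.sq_sqrt hp0.le
  refine ⟨fun hp => ?_, fun hp => ?_⟩
  · have h : dft (fun k => ((legSeq p k : ℤ) : ℂ)) q
        = (legChar p q : ℂ) * (Real.sqrt p : ℂ) + 1 := by
      rw [dft_legSeq hq, gaussSum_legendreMulChar_of_mod_four_eq_one hp]
    refine ⟨h, ?_⟩
    have hne : (Real.sqrt p : ℂ) ≠ 0 := by
      exact_mod_cast (Real.sqrt_pos.mpr hp0).ne'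
    have hfac : (legChar p q : ℂ) * (Real.sqrt p : ℂ) + 1
        = ((legChar p q : ℂ) + 1 / (Real.sqrt p : ℂ)) * (Real.sqrt p : ℂ) := by
      field_simp
    rw [h, hfac, norm_mul, mul_pow, Complex.norm_real, Real.norm_eq_abs, sq_abs, hsqrt]
  · have h : dft (fun k => ((legSeq p k : ℤ) : ℂ)) q
        = (legChar p q : ℂ) * Complex.I * (Real.sqrt p : ℂ) + 1 := by
      rw [dft_legSeq hq, gaussSum_legendreMulChar_of_mod_four_eq_three hp, mul_assoc]
    refine ⟨h, ?_⟩
    have hχ : (legChar p q : ℝ) ^ 2 = 1 := by exact_mod_cast legChar_sq hq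
    have hre : (legChar p q : ℂ) * Complex.I * (Real.sqrt p : ℂ) + 1
        = ((1 : ℝ) : ℂ) + ((legChar p q * Real.sqrt p : ℝ) : ℂ) * Complex.I := by
      push_cast
      ring
    rw [h, hre, Complex.sq_norm, Complex.normSq_add_mul_I, mul_pow, hχ, hsqrt]
    ring
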